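/- The set S_∞^{co} = {y ∈ [0, 2/3] : L(y) is countably infinite} is of first category (meager) in [0, 2/3] and has Lebesgue measure zero. -/

import Mathlib

open Set MeasureTheory ENNReal

/-- `phi x` is the distance from `x` to the nearest integer. -/
noncomputable def phi (x : ℝ) : ℝ := |x - (round x : ℤ)|

/-- The Takagi function. -/
noncomputable def T (x : ℝ) : ℝ := ∑' n : ℕ, phi (2 ^ n * x) / 2 ^ n

/-- The `n`-th binary digit of `x` (terminating expansion for dyadic rationals). -/
noncomputable def eps (n : ℕ) (x : ℝ) : ℤ := ⌊2 ^ n * x⌋ - 2 * ⌊2 ^ (n - 1) * x⌋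

/-- `D k x = ∑_{j=1}^k (-1)^{ε_j(x)}`, the excess of 0 digits over 1 digits. -/
noncomputable def D (k : ℕ) (x : ℝ) : ℤ := ∑ j ∈ Finset.Icc 1 k, (1 - 2 * eps j x)

/-- The level set of the Takagi function at level `y`. -/
def L (y : ℝ) : Set ℝ := {x | x ∈ Set.Icc (0:ℝ) 1 ∧ T x = y}

/-- `x` is a balanced dyadic rational of order `m`. -/
def BalancedOfOrder (x : ℝ) (m : ℕ) : Prop :=
  x ∈ Set.Ico (0:ℝ) 1 ∧ (∃ k : ℤ, x = (k : ℝ) / 2 ^ (2 * m)) ∧ D (2 * m) x = 0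

/-- The generation of a balanced dyadic rational of order `m`:
the number of indices `1 ≤ j ≤ 2m` with `D j x = 0`. -/
noncomputable def generation (x : ℝ) (m : ℕ) : ℕ :=
  ((Finset.Icc 1 (2 * m)).filter (fun j => D j x = 0)).card

/-- A balanced dyadic rational of order `m` is leading if `D j x ≥ 0` for all `1 ≤ j ≤ 2m`. -/
def Leading (x : ℝ) (m : ℕ) : Prop := ∀ j ∈ Finset.Icc 1 (2 * m), 0 ≤ D j x

/-- The equivalence relation whose classes are the local level sets. -/
def locSetoid : Setoid ℝ where
  r x x' := ∀ n : ℕ, 1 ≤ n → |D n x| = |D n x'|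
  iseqv := ⟨fun _ _ _ => rfl, fun h n hn => (h n hn).symm,
    fun h g n hn => (h n hn).trans (g n hn)⟩

/-- The set of local level sets contained in `L y`: the image of `L y ∩ [0,1)`
under the quotient map of `locSetoid`. -/
def locClasses (y : ℝ) : Set (Quotient locSetoid) :=
  Quotient.mk locSetoid '' (L y ∩ Set.Ico (0:ℝ) 1)

open Filter Topology

/-! ### Basic properties of the Takagi function -/

theorem phi_nonneg (x : ℝ) : 0 ≤ phi x := abs_nonneg _

theorem phi_le_half (x : ℝ) : phi x ≤ 1 / 2 := abs_sub_round x

theorem phi_neg_le (x : ℝ) : phi (-x) ≤ phi x := by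
  have h := round_le (-x) (-round x)
  calc phi (-x) ≤ |-x - ((-round x : ℤ) : ℝ)| := h
    _ = phi x := by
      rw [phi, ← abs_neg]
      push_cast
      ring_nf

theorem phi_neg (x : ℝ) : phi (-x) = phi x :=
  le_antisymm (phi_neg_le x) (by simpa using phi_neg_le (-x))

theorem phi_add_int (x : ℝ) (m : ℤ) : phi (x + m) = phi x := by
  simp [phi, round_add_intCast]

theorem phi_of_mem_Icc {x : ℝ} (h0 : 0 ≤ x) (h1 : x ≤ 1 / 2) : phi x = x := by
  rcases h1.lt_or_eq with h1 | rfl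
  · have : round x = 0 := by
      rw [round_eq, Int.floor_eq_iff]
      constructor <;> push_cast <;> linarith
    rw [phi, this, Int.cast_zero, sub_zero, abs_of_nonneg h0]
  · have : round (1 / 2 : ℝ) = 1 := by
      rw [round_eq]
      norm_num
    rw [phi, this]
    norm_num [abs_of_neg]

theorem phi_le_add_abs (x y : ℝ) : phi x ≤ phi y + |x - y| := by
  have h1 : phi x ≤ |x - (round y : ℤ)| := round_le x (round y)
  have h2 : |x - (round y : ℤ)| ≤ |x - y| + |y - (round y : ℤ)| := abs_sub_le _ _ _
  rw [phi] at h1 ⊢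
  rw [phi]
  linarith

theorem continuous_phi : Continuous phi := by
  refine (LipschitzWith.of_dist_le_mul (K := 1) fun x y => ?_).continuous
  rw [Real.dist_eq, Real.dist_eq, abs_sub_le_iff, NNReal.coe_one, one_mul]
  refine ⟨by linarith [phi_le_add_abs x y], ?_⟩
  rw [abs_sub_comm]
  linarith [phi_le_add_abs y x]

theorem hasSum_takagi_bound : HasSum (fun n : ℕ => (1 / 2 : ℝ) / 2 ^ n) 1 := by
  simpa [one_div, div_eq_mul_inv] using hasSum_geometric_two' (1 : ℝ)

theorem takagi_term_nonneg (x : ℝ) (n : ℕ) : 0 ≤ phi (2 ^ n * x) / 2 ^ n :=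
  div_nonneg (phi_nonneg _) (by positivity)

theorem takagi_term_le (x : ℝ) (n : ℕ) : phi (2 ^ n * x) / 2 ^ n ≤ (1 / 2) / 2 ^ n :=
  div_le_div_of_nonneg_right (phi_le_half _) (by positivity)

theorem summable_takagi (x : ℝ) : Summable fun n : ℕ => phi (2 ^ n * x) / 2 ^ n :=
  Summable.of_nonneg_of_le (takagi_term_nonneg x) (takagi_term_le x)
    hasSum_takagi_bound.summable

theorem continuous_T : Continuous T := by
  refine continuous_tsum (u := fun n : ℕ => (1 / 2 : ℝ) / 2 ^ n) (fun n => ?_)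
    hasSum_takagi_bound.summable fun n x => ?_
  · exact (continuous_phi.comp (continuous_const.mul continuous_id)).div_const _
  · rw [Real.norm_of_nonneg (takagi_term_nonneg x n)]
    exact takagi_term_le x n

theorem T_nonneg (x : ℝ) : 0 ≤ T x := tsum_nonneg (takagi_term_nonneg x)

theorem T_le_one (x : ℝ) : T x ≤ 1 := by
  rw [← hasSum_takagi_bound.tsum_eq]
  exact (summable_takagi x).tsum_le_tsum (takagi_term_le x) hasSum_takagi_bound.summable

theorem T_neg (x : ℝ) : T (-x) = T x := by
  simp only [T, mul_neg, phi_neg]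

theorem T_add_one (x : ℝ) : T (x + 1) = T x := by
  refine tsum_congr fun n => ?_
  have := phi_add_int (2 ^ n * x) (2 ^ n)
  push_cast at this
  rw [mul_add, mul_one, this]

theorem T_one_sub (x : ℝ) : T (1 - x) = T x := by
  rw [sub_eq_neg_add, T_add_one, T_neg]

theorem T_eq_phi_add (x : ℝ) : T x = phi x + T (2 * x) / 2 := by
  rw [T, (summable_takagi x).tsum_eq_zero_add, T, ← tsum_div_const]
  simp only [pow_zero, one_mul, div_one]
  congr 1
  refine tsum_congr fun n => ?_
  rw [pow_succ, mul_assoc, div_div]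

theorem T_of_le_half {x : ℝ} (h0 : 0 ≤ x) (h1 : x ≤ 1 / 2) : T x = x + T (2 * x) / 2 := by
  rw [T_eq_phi_add, phi_of_mem_Icc h0 h1]

theorem T_of_half_le {x : ℝ} (h0 : 1 / 2 ≤ x) (h1 : x ≤ 1) :
    T x = 1 - x + T (2 * x - 1) / 2 := by
  rw [← T_one_sub x, T_of_le_half (by linarith) (by linarith), ← T_one_sub (2 * x - 1)]
  ring_nf

theorem T_zero : T 0 = 0 := by
  have := T_of_le_half (x := 0) le_rfl (by norm_num)
  norm_num at this
  linarith

theorem T_one : T 1 = 0 := by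
  have := T_one_sub 0
  rwa [sub_zero, T_zero] at this

theorem T_half : T (1 / 2) = 1 / 2 := by
  rw [T_of_le_half (by norm_num) le_rfl]
  norm_num [T_one]

/-! ### Non-monotonicity on small intervals and the category statement -/

/-- Within distance `1 / 2 ^ n` of `x` inside `[0, 1]`, the function `T u + d * u` takes the same
value at two points and a different value in between. -/
def HasHump (d : ℤ) (x : ℝ) (n : ℕ) : Prop :=
  ∃ p r q : ℝ, p < r ∧ r < q ∧ 0 ≤ p ∧ q ≤ 1 ∧ x - 1 / 2 ^ n ≤ p ∧ q ≤ x + 1 / 2 ^ n ∧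
    T p + d * p = T q + d * q ∧ T p + d * p ≠ T r + d * r

theorem HasHump.left {d : ℤ} {x : ℝ} {n : ℕ} (h : HasHump (d + 1) (2 * x) n) :
    HasHump d x (n + 1) := by
  obtain ⟨p, r, q, hpr, hrq, hp, hq, hxp, hxq, he, hne⟩ := h
  have key : ∀ u : ℝ, 0 ≤ u → u ≤ 1 →
      T (u / 2) + d * (u / 2) = (T u + ((d + 1 : ℤ) : ℝ) * u) / 2 := by
    intro u h0 h1
    rw [T_of_le_half (by linarith) (by linarith), mul_div_cancel₀ u (two_ne_zero)]
    push_cast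
    ring
  refine ⟨p / 2, r / 2, q / 2, by linarith, by linarith, by linarith, by linarith, ?_, ?_, ?_, ?_⟩
  · rw [pow_succ, ← div_div]; linarith
  · rw [pow_succ, ← div_div]; linarith
  · rw [key p hp (by linarith), key q (by linarith) hq, he]
  · rw [key p hp (by linarith), key r (by linarith) (by linarith)]
    intro h
    exact hne (by linarith)

theorem HasHump.right {d : ℤ} {x : ℝ} {n : ℕ} (h : HasHump (d - 1) (2 * x - 1) n) :
    HasHump d x (n + 1) := by
  obtain ⟨p, r, q, hpr, hrq, hp, hq, hxp, hxq, he, hne⟩ := h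
  have key : ∀ u : ℝ, 0 ≤ u → u ≤ 1 →
      T ((1 + u) / 2) + d * ((1 + u) / 2) =
        (T u + ((d - 1 : ℤ) : ℝ) * u) / 2 + (d + 1) / 2 := by
    intro u h0 h1
    rw [T_of_half_le (by linarith) (by linarith), mul_div_cancel₀ _ (two_ne_zero),
      add_sub_cancel_left]
    push_cast
    ring
  refine ⟨(1 + p) / 2, (1 + r) / 2, (1 + q) / 2, by linarith, by linarith, by linarith,
    by linarith, ?_, ?_, ?_, ?_⟩
  · rw [pow_succ, ← div_div]; linarith
  · rw [pow_succ, ← div_div]; linarith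
  · rw [key p hp (by linarith), key q (by linarith) hq, he]
  · rw [key p hp (by linarith), key r (by linarith) (by linarith)]
    intro h
    exact hne (by linarith)

theorem HasHump.to_zero {d : ℤ} {x y : ℝ} {n : ℕ} (h : HasHump d y n) (h0 : 0 ≤ x) (h1 : x ≤ 1) :
    HasHump d x 0 := by
  obtain ⟨p, r, q, hpr, hrq, hp, hq, -, -, he, hne⟩ := h
  refine ⟨p, r, q, hpr, hrq, hp, hq, ?_, ?_, he, hne⟩ <;> norm_num <;> linarith

theorem hasHump_zero (d : ℤ) : ∀ x : ℝ, 0 ≤ x → x ≤ 1 → HasHump d x 0 := by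
  induction d with
  | zero =>
    intro x h0 h1
    refine ⟨0, 1 / 2, 1, by norm_num, by norm_num, le_rfl, le_rfl, ?_, ?_, ?_, ?_⟩
    · norm_num; linarith
    · norm_num; linarith
    · simp [T_zero, T_one]
    · simp only [T_zero, T_half]
      norm_num
  | succ i ih =>
    intro x h0 h1
    have := ih 1 zero_le_one le_rfl
    exact (HasHump.right (d := (i : ℤ) + 1) (x := 1) (by norm_num; exact this)).to_zero h0 h1
  | pred i ih =>
    intro x h0 h1
    have := ih 0 le_rfl zero_le_one
    exact (HasHump.left (d := -(i : ℤ) - 1) (x := 0) (by simpa using this)).to_zero h0 h1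

theorem hasHump (n : ℕ) : ∀ (d : ℤ) (x : ℝ), 0 ≤ x → x ≤ 1 → HasHump d x n := by
  induction n with
  | zero => exact hasHump_zero
  | succ n ih =>
    intro d x h0 h1
    rcases le_total x (1 / 2) with h | h
    · exact (ih _ _ (by linarith) (by linarith)).left
    · exact (ih _ _ (by linarith) (by linarith)).right

/-- The levels attained exactly once by `T` on `(a, b) ∩ [0, 1]`. -/
def uniqueLevels (a b : ℝ) : Set ℝ := {y | ∃! x, x ∈ Ioo a b ∧ x ∈ L y}

/-- Between two points with equal values, all values up to an intermediate one are taken twice. -/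
theorem exists_isOpen_two_preimages {f : ℝ → ℝ} (hf : Continuous f) {p r q : ℝ} (hpr : p < r)
    (hrq : r < q) (he : f p = f q) (hne : f p ≠ f r) :
    ∃ J : Set ℝ, IsOpen J ∧ J.Nonempty ∧
      ∀ v ∈ J, ∃ z ∈ Icc p q, ∃ z' ∈ Icc p q, z ≠ z' ∧ f z = v ∧ f z' = v := by
  have hc : ∀ s : Set ℝ, ContinuousOn f s := fun s => hf.continuousOn
  rcases lt_or_gt_of_ne hne with h | h
  · refine ⟨Ioo (f p) (f r), isOpen_Ioo, nonempty_Ioo.2 h, fun v hv => ?_⟩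
    obtain ⟨z, hz, hzv⟩ := intermediate_value_Ioo hpr.le (hc _) hv
    obtain ⟨z', hz', hzv'⟩ := intermediate_value_Ioo' hrq.le (hc _) (he ▸ hv)
    exact ⟨z, ⟨hz.1.le, (hz.2.trans hrq).le⟩, z', ⟨(hpr.trans hz'.1).le, hz'.2.le⟩,
      (hz.2.trans hz'.1).ne, hzv, hzv'⟩
  · refine ⟨Ioo (f r) (f p), isOpen_Ioo, nonempty_Ioo.2 h, fun v hv => ?_⟩
    obtain ⟨z, hz, hzv⟩ := intermediate_value_Ioo' hpr.le (hc _) hv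
    obtain ⟨z', hz', hzv'⟩ := intermediate_value_Ioo hrq.le (hc _) (he ▸ hv)
    exact ⟨z, ⟨hz.1.le, (hz.2.trans hrq).le⟩, z', ⟨(hpr.trans hz'.1).le, hz'.2.le⟩,
      (hz.2.trans hz'.1).ne, hzv, hzv'⟩

theorem isNowhereDense_uniqueLevels (a b : ℝ) : IsNowhereDense (uniqueLevels a b) := by
  rw [IsNowhereDense, eq_empty_iff_forall_notMem]
  intro y₀ hy₀
  set O := interior (closure (uniqueLevels a b))
  have hO : IsOpen O := isOpen_interior
  obtain ⟨y, hyO, x, ⟨hxab, hx01, hxy⟩, -⟩ :=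
    mem_closure_iff.1 (interior_subset hy₀) O hO hy₀
  have hU : T ⁻¹' O ∩ Ioo a b ∈ 𝓝 x :=
    inter_mem (continuous_T.continuousAt (hO.mem_nhds (hxy ▸ hyO))) (isOpen_Ioo.mem_nhds hxab)
  obtain ⟨δ, hδ, hball⟩ := Metric.nhds_basis_closedBall.mem_iff.1 hU
  obtain ⟨n, hn⟩ := exists_pow_lt_of_lt_one hδ (show (1 / 2 : ℝ) < 1 by norm_num)
  obtain ⟨p, r, q, hpr, hrq, hp, hq, hxp, hxq, he, hne⟩ := hasHump n 0 x hx01.1 hx01.2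
  simp only [Int.cast_zero, zero_mul, add_zero] at he hne
  rw [one_div_pow] at hn
  have hmem : ∀ z ∈ Icc p q, z ∈ Icc (0 : ℝ) 1 ∧ T z ∈ O ∧ z ∈ Ioo a b := by
    intro z hz
    refine ⟨⟨hp.trans hz.1, hz.2.trans hq⟩, hball ?_⟩
    rw [Metric.mem_closedBall, Real.dist_eq, abs_le]
    constructor <;> linarith [hz.1, hz.2]
  obtain ⟨J, hJ, ⟨v₀, hv₀⟩, hJ2⟩ := exists_isOpen_two_preimages continuous_T hpr hrq he hne
  have hv₀c : v₀ ∈ closure (uniqueLevels a b) := by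
    obtain ⟨z, hz, -, -, -, rfl, -⟩ := hJ2 v₀ hv₀
    exact interior_subset (hmem z hz).2.1
  obtain ⟨v, hvJ, w, -, hw⟩ := mem_closure_iff.1 hv₀c J hJ hv₀
  obtain ⟨z, hz, z', hz', hzz, hzv, hzv'⟩ := hJ2 v hvJ
  exact hzz ((hw z ⟨(hmem z hz).2.2, (hmem z hz).1, hzv⟩).trans
    (hw z' ⟨(hmem z' hz').2.2, (hmem z' hz').1, hzv'⟩).symm)

theorem isClosed_L (y : ℝ) : IsClosed (L y) :=
  isClosed_Icc.inter (isClosed_eq continuous_T continuous_const)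

theorem exists_mem_not_accPt_of_countable {s : Set ℝ} (hs : IsClosed s) (hne : s.Nonempty)
    (hc : s.Countable) : ∃ x ∈ s, ¬ AccPt x (𝓟 s) := by
  by_contra! h
  obtain ⟨f, hfs, -, hf⟩ := Perfect.exists_nat_bool_injection ⟨hs, fun x hx => h x hx⟩ hne
  have : Countable (range f) := hc.mono hfs
  have hcard := Cardinal.mk_le_aleph0_iff.2 ((rangeFactorization_injective.2 hf).countable)
  refine absurd hcard (not_le.2 ?_)
  simpa using Cardinal.cantor Cardinal.aleph0

theorem mem_uniqueLevels_of_countable {y : ℝ} (hne : (L y).Nonempty) (hc : (L y).Countable) :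
    ∃ a b : ℚ, y ∈ uniqueLevels a b := by
  obtain ⟨x, hx, hacc⟩ := exists_mem_not_accPt_of_countable (isClosed_L y) hne hc
  rw [accPt_iff_nhds] at hacc
  push Not at hacc
  obtain ⟨U, hU, hUx⟩ := hacc
  obtain ⟨δ, hδ, hball⟩ := Metric.mem_nhds_iff.1 hU
  obtain ⟨a, ha, hax⟩ := exists_rat_btwn (show x - δ < x by linarith)
  obtain ⟨b, hxb, hb⟩ := exists_rat_btwn (show x < x + δ by linarith)
  refine ⟨a, b, x, ⟨⟨hax, hxb⟩, hx⟩, fun z hz => hUx z ⟨hball ?_, hz.2⟩⟩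
  rw [Metric.mem_ball, Real.dist_eq, abs_lt]
  constructor <;> linarith [hz.1.1, hz.1.2]

theorem isMeagre_countable_levels : IsMeagre {y : ℝ | (L y).Nonempty ∧ (L y).Countable} := by
  refine (isMeagre_iUnion fun a : ℚ => isMeagre_iUnion fun b : ℚ =>
    (isNowhereDense_uniqueLevels a b).isMeagre).mono ?_
  rintro y ⟨hne, hc⟩
  obtain ⟨a, b, h⟩ := mem_uniqueLevels_of_countable hne hc
  exact mem_iUnion₂.2 ⟨a, b, h⟩

/-! ### Almost every level set is finite -/

/-- A weighted count of the dyadic intervals of order `n` on which the function `T u + d * u` may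
attain the value `y`; a pair of intervals that are mirror images of each other is counted with
weight `3 / 2` instead of `2`. -/
noncomputable def levelWeight : ℕ → ℕ → ℝ → ℝ≥0∞
  | 0, d => indicator (Icc 0 ((d : ℝ) + 1)) 1
  | n + 1, 0 => fun y => 3 / 2 * levelWeight n 1 (2 * y)
  | n + 1, d + 1 => fun y => levelWeight n (d + 2) (2 * y) + levelWeight n d (2 * y - (d + 2))

theorem measurable_levelWeight (n : ℕ) : ∀ d : ℕ, Measurable (levelWeight n d) := by
  induction n with
  | zero => exact fun d => measurable_one.indicator measurableSet_Icc
  | succ n ih =>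
    rintro (_ | d)
    · exact ((ih 1).comp (measurable_const.mul measurable_id)).const_mul _
    · exact ((ih (d + 2)).comp (measurable_const.mul measurable_id)).add
        ((ih d).comp ((measurable_const.mul measurable_id).sub measurable_const))

theorem lintegral_comp_two_mul_sub {f : ℝ → ℝ≥0∞} (hf : Measurable f) (c : ℝ) :
    ∫⁻ y, f (2 * y - c) = 2⁻¹ * ∫⁻ y, f y := by
  have h1 : ∫⁻ y, f (2 * y - c) = ∫⁻ z, f (z - c) ∂(Measure.map (2 * ·) volume) :=
    (lintegral_map (hf.comp (measurable_id.sub measurable_const))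
      (measurable_const.mul measurable_id)).symm
  rw [h1, Real.map_volume_mul_left two_ne_zero, lintegral_smul_measure,
    lintegral_sub_right_eq_self, abs_of_pos (by norm_num),
    ENNReal.ofReal_inv_of_pos two_pos, ENNReal.ofReal_ofNat, smul_eq_mul]

theorem lintegral_comp_two_mul {f : ℝ → ℝ≥0∞} (hf : Measurable f) :
    ∫⁻ y, f (2 * y) = 2⁻¹ * ∫⁻ y, f y := by
  simpa using lintegral_comp_two_mul_sub hf 0

theorem lintegral_levelWeight_le (n : ℕ) : ∀ d : ℕ,
    ∫⁻ y, levelWeight n d y ≤ ENNReal.ofReal (d + 3) := by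
  have two_inv : (2⁻¹ : ℝ≥0∞) = ENNReal.ofReal 2⁻¹ := by
    rw [ENNReal.ofReal_inv_of_pos two_pos, ENNReal.ofReal_ofNat]
  induction n with
  | zero =>
    intro d
    rw [levelWeight, lintegral_indicator_one measurableSet_Icc, Real.volume_Icc]
    exact ENNReal.ofReal_le_ofReal (by linarith)
  | succ n ih =>
    rintro (_ | d)
    · have h32 : (3 / 2 : ℝ≥0∞) = ENNReal.ofReal (3 / 2) := by
        rw [ENNReal.ofReal_div_of_pos two_pos, ENNReal.ofReal_ofNat, ENNReal.ofReal_ofNat]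
      have hm := measurable_levelWeight n 1
      simp only [levelWeight]
      rw [lintegral_const_mul _ (by fun_prop), lintegral_comp_two_mul hm]
      calc 3 / 2 * (2⁻¹ * ∫⁻ y, levelWeight n 1 y)
          ≤ 3 / 2 * (2⁻¹ * ENNReal.ofReal ((1 : ℕ) + 3)) := by gcongr; exact ih 1
        _ = ENNReal.ofReal ((0 : ℕ) + 3) := by
          rw [h32, two_inv, ← ENNReal.ofReal_mul (by norm_num),
            ← ENNReal.ofReal_mul (by norm_num)]
          norm_num
    · have hm := measurable_levelWeight n (d + 2)
      have hm' := measurable_levelWeight n d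
      simp only [levelWeight]
      rw [lintegral_add_left (by fun_prop), lintegral_comp_two_mul hm, lintegral_comp_two_mul_sub hm']
      calc 2⁻¹ * (∫⁻ y, levelWeight n (d + 2) y) + 2⁻¹ * ∫⁻ y, levelWeight n d y
          ≤ 2⁻¹ * ENNReal.ofReal ((d + 2 : ℕ) + 3) + 2⁻¹ * ENNReal.ofReal (d + 3) := by
            gcongr
            · exact ih (d + 2)
            · exact ih d
        _ = ENNReal.ofReal ((d + 1 : ℕ) + 3) := by
          rw [two_inv, ← ENNReal.ofReal_mul (by norm_num), ← ENNReal.ofReal_mul (by norm_num),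
            ← ENNReal.ofReal_add (by positivity) (by positivity)]
          congr 1
          push_cast
          ring

/-- The exponent `s` with `2 ^ s = 3 / 2`. -/
noncomputable def weightExp : ℝ := Real.logb 2 (3 / 2)

theorem weightExp_pos : 0 < weightExp := Real.logb_pos (by norm_num) (by norm_num)

theorem weightExp_le_one : weightExp ≤ 1 := by
  rw [weightExp, Real.logb_le_iff_le_rpow (by norm_num) (by norm_num)]
  norm_num

theorem two_rpow_weightExp : (2 : ℝ≥0∞) ^ weightExp = 3 / 2 := by
  rw [← ENNReal.ofReal_ofNat 2, ENNReal.ofReal_rpow_of_pos two_pos, weightExp,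
    Real.rpow_logb two_pos (by norm_num) (by norm_num), ENNReal.ofReal_div_of_pos two_pos,
    ENNReal.ofReal_ofNat, ENNReal.ofReal_ofNat]

/-- A finite set of solutions of `T u + d * u = y` in `[0, 1]` with gaps larger than
`1 / 2 ^ n`. -/
structure SeparatedSolutions (n d : ℕ) (y : ℝ) (F : Finset ℝ) : Prop where
  mem_Icc : ∀ u ∈ F, u ∈ Icc (0 : ℝ) 1
  eq : ∀ u ∈ F, T u + d * u = y
  sep : ∀ u ∈ F, ∀ v ∈ F, u ≠ v → 1 / 2 ^ n < |u - v|

theorem SeparatedSolutions.exists_rescale {n d d' : ℕ} {y y' : ℝ} {F : Finset ℝ}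
    (hF : SeparatedSolutions (n + 1) d y F) {g : ℝ → ℝ} {p : ℝ → Prop} [DecidablePred p]
    (hg : ∀ u v, |g u - g v| = 2 * |u - v|)
    (hgI : ∀ u ∈ Icc (0 : ℝ) 1, p u → g u ∈ Icc (0 : ℝ) 1)
    (hgy : ∀ u ∈ Icc (0 : ℝ) 1, p u → T u + d * u = y → T (g u) + d' * g u = y') :
    ∃ G : Finset ℝ, SeparatedSolutions n d' y' G ∧ G.card = (F.filter p).card := by
  have hinj : Function.Injective g := by
    intro u v huv
    have := hg u v
    rw [huv, sub_self, abs_zero] at this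
    exact sub_eq_zero.1 (abs_eq_zero.1 (by linarith))
  refine ⟨(F.filter p).image g, ⟨?_, ?_, ?_⟩, Finset.card_image_of_injective _ hinj⟩
  · simp only [Finset.mem_image, Finset.mem_filter]
    rintro _ ⟨u, ⟨hu, hpu⟩, rfl⟩
    exact hgI u (hF.mem_Icc u hu) hpu
  · simp only [Finset.mem_image, Finset.mem_filter]
    rintro _ ⟨u, ⟨hu, hpu⟩, rfl⟩
    exact hgy u (hF.mem_Icc u hu) hpu (hF.eq u hu)
  · simp only [Finset.mem_image, Finset.mem_filter]
    rintro _ ⟨u, ⟨hu, -⟩, rfl⟩ _ ⟨v, ⟨hv, -⟩, rfl⟩ huv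
    have := hF.sep u hu v hv (fun h => huv (h ▸ rfl))
    rw [pow_succ, ← div_div] at this
    rw [hg]
    linarith

theorem SeparatedSolutions.card_rpow_le {n : ℕ} : ∀ {d : ℕ} {y : ℝ} {F : Finset ℝ},
    SeparatedSolutions n d y F → (F.card : ℝ≥0∞) ^ weightExp ≤ levelWeight n d y := by
  classical
  induction n with
  | zero =>
    intro d y F hF
    rcases F.eq_empty_or_nonempty with rfl | ⟨u, hu⟩
    · simp [ENNReal.zero_rpow_of_pos weightExp_pos]
    have hcard : F.card ≤ 1 := by
      refine Finset.card_le_one.2 fun v hv w hw => ?_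
      by_contra hvw
      have h1 := hF.sep v hv w hw hvw
      have hv' := hF.mem_Icc v hv
      have hw' := hF.mem_Icc w hw
      rw [pow_zero, div_one] at h1
      exact absurd h1 (not_lt.2 (abs_le.2
        ⟨by linarith [hv'.1, hw'.2], by linarith [hv'.2, hw'.1]⟩))
    have hu' := hF.mem_Icc u hu
    have hy : y ∈ Icc (0 : ℝ) (d + 1) := by
      rw [← hF.eq u hu]
      have hd : (0 : ℝ) ≤ d := d.cast_nonneg
      exact ⟨add_nonneg (T_nonneg u) (mul_nonneg hd hu'.1),
        by nlinarith [T_le_one u, hu'.2]⟩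
    rw [levelWeight, indicator_of_mem hy, Pi.one_apply]
    exact ENNReal.rpow_le_one (by exact_mod_cast hcard) weightExp_pos.le
  | succ n ih =>
    intro d y F hF
    have hsplit : F.card = (F.filter (· ≤ 1 / 2)).card + (F.filter (¬ · ≤ 1 / 2)).card :=
      (Finset.card_filter_add_card_filter_not _).symm
    obtain ⟨G₁, hG₁, hc₁⟩ := hF.exists_rescale (d' := d + 1) (y' := 2 * y) (g := fun u => 2 * u)
      (p := (· ≤ 1 / 2)) (fun u v => by rw [← mul_sub, abs_mul, abs_two])
      (fun u hu hpu => ⟨by linarith [hu.1], by linarith⟩)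
      (fun u hu hpu h => by
        rw [T_of_le_half hu.1 hpu] at h
        push_cast
        linarith)
    have h₁ := ih hG₁
    rcases d with _ | d
    · obtain ⟨G₂, hG₂, hc₂⟩ := hF.exists_rescale (d' := 1) (y' := 2 * y)
        (g := fun u => 2 * (1 - u)) (p := (¬ · ≤ 1 / 2))
        (fun u v => by rw [← mul_sub, abs_mul, abs_two, abs_sub_comm u v]; ring_nf)
        (fun u hu hpu => ⟨by linarith [hu.2], by linarith [not_le.1 hpu]⟩)
        (fun u hu hpu h => by
          rw [← T_one_sub, T_of_le_half (by linarith [hu.2]) (by linarith [not_le.1 hpu])] at h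
          push_cast at h ⊢
          linarith)
      have h₂ := ih hG₂
      rw [levelWeight, ← two_rpow_weightExp]
      have hle : F.card ≤ 2 * max G₁.card G₂.card := by
        rw [hsplit, ← hc₁, ← hc₂]
        omega
      calc (F.card : ℝ≥0∞) ^ weightExp
          ≤ (2 * (max G₁.card G₂.card : ℕ)) ^ weightExp :=
            ENNReal.rpow_le_rpow (by exact_mod_cast hle) weightExp_pos.le
        _ = 2 ^ weightExp * ((max G₁.card G₂.card : ℕ) : ℝ≥0∞) ^ weightExp :=
            ENNReal.mul_rpow_of_nonneg _ _ weightExp_pos.le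
        _ ≤ 2 ^ weightExp * levelWeight n 1 (2 * y) := by
            gcongr
            rcases max_choice G₁.card G₂.card with h | h <;> rw [h]
            · exact h₁
            · exact h₂
    · obtain ⟨G₂, hG₂, hc₂⟩ := hF.exists_rescale (d' := d) (y' := 2 * y - (d + 2))
        (g := fun u => 2 * u - 1) (p := (¬ · ≤ 1 / 2))
        (fun u v => by rw [sub_sub_sub_cancel_right, ← mul_sub, abs_mul, abs_two])
        (fun u hu hpu => ⟨by linarith [not_le.1 hpu], by linarith [hu.2]⟩)
        (fun u hu hpu h => by
          rw [T_of_half_le (not_le.1 hpu).le hu.2] at h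
          push_cast at h ⊢
          linarith)
      have h₂ := ih hG₂
      rw [levelWeight, hsplit, ← hc₁, ← hc₂, Nat.cast_add]
      exact (ENNReal.rpow_add_le_add_rpow _ _ weightExp_pos.le weightExp_le_one).trans
        (add_le_add h₁ h₂)

theorem Finset.exists_pow_two_separated (F : Finset ℝ) :
    ∃ N : ℕ, ∀ n ≥ N, ∀ u ∈ F, ∀ v ∈ F, u ≠ v → 1 / 2 ^ n < |u - v| := by
  have h : ∀ᶠ n : ℕ in atTop, ∀ u ∈ F, ∀ v ∈ F, u ≠ v → (1 : ℝ) / 2 ^ n < |u - v| := by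
    rw [Filter.eventually_all_finset]
    intro u _
    rw [Filter.eventually_all_finset]
    intro v _
    by_cases huv : u = v
    · simp [huv]
    have hlim : Tendsto (fun n : ℕ => (1 : ℝ) / 2 ^ n) atTop (𝓝 0) := by
      simpa [one_div_pow] using
        tendsto_pow_atTop_nhds_zero_of_lt_one (r := (1 / 2 : ℝ)) (by norm_num) (by norm_num)
    filter_upwards [hlim.eventually_lt_const (abs_pos.2 (sub_ne_zero.2 huv))] with n hn _
    exact hn
  exact eventually_atTop.1 h

theorem liminf_levelWeight_eq_top {y : ℝ} (hy : (L y).Infinite) :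
    liminf (fun n => levelWeight n 0 y) atTop = ∞ := by
  have hk : ∀ k : ℕ, (k : ℝ≥0∞) ^ weightExp ≤ liminf (fun n => levelWeight n 0 y) atTop := by
    intro k
    obtain ⟨F, hFL, rfl⟩ := hy.exists_subset_card_eq k
    obtain ⟨N, hN⟩ := F.exists_pow_two_separated
    refine le_liminf_of_le (by isBoundedDefault) (eventually_atTop.2 ⟨N, fun n hn => ?_⟩)
    exact SeparatedSolutions.card_rpow_le
      ⟨fun u hu => (hFL hu).1, fun u hu => by simpa using (hFL hu).2, hN n hn⟩
  have hlim : Tendsto (fun k : ℕ => (k : ℝ≥0∞) ^ weightExp) atTop (𝓝 ∞) := by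
    have := (ENNReal.continuous_rpow_const (y := weightExp)).continuousAt.tendsto.comp
      ENNReal.tendsto_nat_nhds_top
    rwa [ENNReal.top_rpow_of_pos weightExp_pos] at this
  exact top_le_iff.1 (le_of_tendsto' hlim hk)

theorem volume_infinite_levels : volume {y : ℝ | (L y).Infinite} = 0 := by
  have hint : ∫⁻ y, liminf (fun n => levelWeight n 0 y) atTop ≠ ∞ := by
    refine ne_top_of_le_ne_top (ENNReal.ofReal_ne_top (r := (0 : ℕ) + 3))
      ((lintegral_liminf_le fun n => measurable_levelWeight n 0).trans ?_)
    refine liminf_le_of_le (by isBoundedDefault) fun b hb => ?_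
    obtain ⟨n, hn⟩ := hb.exists
    exact hn.trans (lintegral_levelWeight_le n 0)
  have hae := ae_lt_top (Measurable.liminf fun n => measurable_levelWeight n 0) hint
  exact measure_mono_null (fun y hy => not_lt.2 (liminf_levelWeight_eq_top hy).ge) (ae_iff.1 hae)

theorem stmt16 :
    IsMeagre {y : ℝ | y ∈ Set.Icc (0:ℝ) (2/3) ∧ (L y).Countable ∧ (L y).Infinite} ∧
    volume {y : ℝ | y ∈ Set.Icc (0:ℝ) (2/3) ∧ (L y).Countable ∧ (L y).Infinite} = 0 := by
  refine ⟨isMeagre_countable_levels.mono ?_,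
    measure_mono_null (fun _ hy => hy.2.2) volume_infinite_levels⟩
  exact fun y hy => ⟨hy.2.2.nonempty, hy.2.1⟩
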